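/- arXiv:1805.06101 — 2 statements merged into one kernel-verified Lean document; each statement's English description precedes it below -/
import Mathlib

section
/- (Maximal Selection Principle) Let (c_k)_{k≥0} be a square-summable sequence of complex numbers and F(z) = ∑_{k=0}^∞ c_k z^k for z in the open unit disc 𝔻. The continuous function a ↦ (1 - |a|²)|F(a)|² attains its supremum over 𝔻 at some point a₁ ∈ 𝔻; that is, there exists a₁ ∈ 𝔻 with (1 - |a₁|²)|F(a₁)|² ≥ (1 - |a|²)|F(a)|² for all a ∈ 𝔻. -/
open Complex

lemma msp_summable (c : ℕ → ℂ) (hc : Summable fun k => ‖c k‖ ^ 2) (r : ℝ) (h0 : 0 ≤ r)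
    (h1 : r < 1) : Summable fun k => ‖c k‖ * r ^ k := by
  have hg : Summable fun k : ℕ => (r ^ 2) ^ k :=
    summable_geometric_of_lt_one (by positivity) (by nlinarith)
  refine Summable.of_nonneg_of_le (fun k => by positivity) (fun k => ?_) (hc.add hg)
  have : (r ^ 2) ^ k = (r ^ k) ^ 2 := by rw [← pow_mul, ← pow_mul, mul_comm]
  rw [this]
  nlinarith [sq_nonneg (‖c k‖ - r ^ k), sq_nonneg (‖c k‖), sq_nonneg (r ^ k)]

lemma msp_summable' (c : ℕ → ℂ) (hc : Summable fun k => ‖c k‖ ^ 2) (z : ℂ)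
    (h1 : ‖z‖ < 1) : Summable fun k => c k * z ^ k := by
  refine Summable.of_norm ?_
  simpa using msp_summable c hc ‖z‖ (norm_nonneg _) h1

lemma msp_cs (c : ℕ → ℂ) (hc : Summable fun k => ‖c k‖ ^ 2) (z : ℂ) (h1 : ‖z‖ < 1) :
    (1 - ‖z‖ ^ 2) * ‖∑' k, c k * z ^ k‖ ^ 2 ≤ ∑' k, ‖c k‖ ^ 2 := by
  have hz : ‖z‖ ^ 2 < 1 := by nlinarith [norm_nonneg z]
  have hpos : 0 < 1 - ‖z‖ ^ 2 := by linarith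
  have hg : Summable fun k : ℕ => (‖z‖ ^ 2) ^ k :=
    summable_geometric_of_lt_one (by positivity) hz
  have key : ‖∑' k, c k * z ^ k‖ ^ 2 ≤ (∑' k, ‖c k‖ ^ 2) * (1 - ‖z‖ ^ 2)⁻¹ := by
    have ht := ((msp_summable' c hc z h1).hasSum.tendsto_sum_nat.norm).pow 2
    refine le_of_tendsto' ht (fun n => ?_)
    have e1 : ‖∑ k ∈ Finset.range n, c k * z ^ k‖ ≤
        ∑ k ∈ Finset.range n, ‖c k‖ * ‖z‖ ^ k := by
      refine (norm_sum_le _ _).trans (le_of_eq ?_)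
      simp
    have e2 := Finset.sum_mul_sq_le_sq_mul_sq (Finset.range n) (fun k => ‖c k‖)
      (fun k => ‖z‖ ^ k)
    have e3 : ∑ k ∈ Finset.range n, ‖c k‖ ^ 2 ≤ ∑' k, ‖c k‖ ^ 2 :=
      hc.sum_le_tsum _ (fun k _ => by positivity)
    have e4 : ∑ k ∈ Finset.range n, (‖z‖ ^ k) ^ 2 ≤ (1 - ‖z‖ ^ 2)⁻¹ := by
      rw [← tsum_geometric_of_lt_one (by positivity) hz]
      refine le_trans (le_of_eq ?_) (hg.sum_le_tsum (Finset.range n) (fun k _ => by positivity))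
      exact Finset.sum_congr rfl fun k _ => by rw [← pow_mul, ← pow_mul, mul_comm]
    calc _ ≤ (∑ k ∈ Finset.range n, ‖c k‖ * ‖z‖ ^ k) ^ 2 := by gcongr
      _ ≤ _ := e2
      _ ≤ _ := mul_le_mul e3 e4 (Finset.sum_nonneg fun k _ => by positivity)
          (tsum_nonneg fun k => by positivity)
  calc _ ≤ (1 - ‖z‖ ^ 2) * ((∑' k, ‖c k‖ ^ 2) * (1 - ‖z‖ ^ 2)⁻¹) := by gcongr
    _ = _ := by field_simp

lemma msp_bound (c : ℕ → ℂ) (hc : Summable fun k => ‖c k‖ ^ 2) (N : ℕ) (z : ℂ) (h1 : ‖z‖ < 1) :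
    (1 - ‖z‖ ^ 2) * ‖∑' k, c k * z ^ k‖ ^ 2 ≤
      2 * ((1 - ‖z‖ ^ 2) * (∑ k ∈ Finset.range N, ‖c k‖) ^ 2) + 2 * ∑' k, ‖c (k + N)‖ ^ 2 := by
  have hpos : 0 < 1 - ‖z‖ ^ 2 := by nlinarith [norm_nonneg z]
  have hcs := msp_cs (fun k => c (k + N)) ((summable_nat_add_iff (f := fun k => ‖c k‖ ^ 2) N).2 hc) z h1
  have hsplit := (msp_summable' c hc z h1).sum_add_tsum_nat_add N
  have ht : ∑' k, c (k + N) * z ^ (k + N) = z ^ N * ∑' k, c (k + N) * z ^ k := by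
    rw [← tsum_mul_left]
    exact tsum_congr fun k => by ring
  have hA : ‖∑ k ∈ Finset.range N, c k * z ^ k‖ ≤ ∑ k ∈ Finset.range N, ‖c k‖ := by
    refine norm_sum_le_of_le _ fun k _ => ?_
    rw [norm_mul, norm_pow]
    exact mul_le_of_le_one_right (norm_nonneg _) (pow_le_one₀ (norm_nonneg _) h1.le)
  have hB : ‖z ^ N * ∑' k, c (k + N) * z ^ k‖ ≤ ‖∑' k, c (k + N) * z ^ k‖ := by
    rw [norm_mul, norm_pow]
    exact mul_le_of_le_one_left (norm_nonneg _) (pow_le_one₀ (norm_nonneg _) h1.le)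
  rw [← hsplit, ht]
  set A := ∑ k ∈ Finset.range N, ‖c k‖
  set B := ‖∑' k, c (k + N) * z ^ k‖
  have h3 := (norm_add_le (∑ k ∈ Finset.range N, c k * z ^ k)
    (z ^ N * ∑' k, c (k + N) * z ^ k)).trans (add_le_add hA hB)
  have h4 := pow_le_pow_left₀ (norm_nonneg _) h3 2
  have h5 : (A + B) ^ 2 ≤ 2 * A ^ 2 + 2 * B ^ 2 := by nlinarith [sq_nonneg (A - B)]
  have h6 := mul_le_mul_of_nonneg_left (h4.trans h5) hpos.le
  linarith

/-- Maximal Selection Principle: If `(c_k)` is square-summable and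
`F(z) = ∑ c_k z^k` on the open unit disc, then the function `a ↦ (1 - |a|²)|F(a)|²`
attains its supremum over the disc at some point `a₁` of the disc. -/
theorem maximal_selection_principle
    (c : ℕ → ℂ) (hc : Summable fun k => ‖c k‖ ^ 2)
    (F : ℂ → ℂ) (hF : ∀ z : ℂ, ‖z‖ < 1 → F z = ∑' k : ℕ, c k * z ^ k) :
    ∃ a₁ : ℂ, ‖a₁‖ < 1 ∧
      ∀ a : ℂ, ‖a‖ < 1 → (1 - ‖a‖ ^ 2) * ‖F a‖ ^ 2 ≤ (1 - ‖a₁‖ ^ 2) * ‖F a₁‖ ^ 2 := by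
  by_cases hz : ∀ a : ℂ, ‖a‖ < 1 → (1 - ‖a‖ ^ 2) * ‖F a‖ ^ 2 ≤ 0
  · refine ⟨0, by simp, fun a ha => (hz a ha).trans ?_⟩
    simp
  push Not at hz
  obtain ⟨b, hb, hG⟩ := hz
  set g := (1 - ‖b‖ ^ 2) * ‖F b‖ ^ 2 with hg
  obtain ⟨N, hN⟩ := ((tendsto_sum_nat_add fun k => ‖c k‖ ^ 2).eventually
    (gt_mem_nhds (show (0:ℝ) < g / 4 by positivity))).exists
  set A := ∑ k ∈ Finset.range N, ‖c k‖ with hA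
  -- choose the radius
  have hlim : Filter.Tendsto (fun r : ℝ => 2 * ((1 - r ^ 2) * A ^ 2)) (nhds 1) (nhds 0) := by
    have : Continuous (fun r : ℝ => 2 * ((1 - r ^ 2) * A ^ 2)) := by fun_prop
    simpa using this.tendsto 1
  obtain ⟨ε, hε, hball⟩ := Metric.eventually_nhds_iff.1
    (hlim.eventually (gt_mem_nhds (show (0:ℝ) < g / 2 by positivity)))
  set R := max (1 - ε / 2) ‖b‖ with hR
  have hR1 : R < 1 := max_lt (by linarith) hb
  have hR0 : 0 ≤ R := (norm_nonneg b).trans (le_max_right _ _)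
  have hcont : ContinuousOn F (Metric.closedBall 0 R) := by
    have : ContinuousOn (fun z : ℂ => ∑' k : ℕ, c k * z ^ k) (Metric.closedBall 0 R) := by
      refine continuousOn_tsum (fun k => by fun_prop) (msp_summable c hc R hR0 hR1) ?_
      intro k z hz
      rw [mem_closedBall_zero_iff] at hz
      rw [norm_mul, norm_pow]
      gcongr
    refine this.congr fun z hz => hF z ?_
    rw [mem_closedBall_zero_iff] at hz
    linarith
  have hcont2 : ContinuousOn (fun a => (1 - ‖a‖ ^ 2) * ‖F a‖ ^ 2) (Metric.closedBall 0 R) :=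
    (by fun_prop : Continuous fun a : ℂ => 1 - ‖a‖ ^ 2).continuousOn.mul (hcont.norm.pow 2)
  have hbm : b ∈ Metric.closedBall (0:ℂ) R := by
    rw [mem_closedBall_zero_iff]; exact le_max_right _ _
  obtain ⟨a₁, ha₁, hmax⟩ := (isCompact_closedBall (0:ℂ) R).exists_isMaxOn ⟨b, hbm⟩ hcont2
  refine ⟨a₁, (mem_closedBall_zero_iff.1 ha₁).trans_lt hR1, fun a ha => ?_⟩
  by_cases haR : ‖a‖ ≤ R
  · exact hmax (mem_closedBall_zero_iff.2 haR)
  · refine le_trans ?_ (hmax hbm)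
    push Not at haR
    have h1 : 1 - ε / 2 < ‖a‖ := (le_max_left _ _).trans_lt haR
    have h2 := hball (y := ‖a‖) (by rw [Real.dist_eq, abs_lt]; constructor <;> linarith)
    have h3 := msp_bound c hc N a ha
    rw [← hF a ha] at h3
    show _ ≤ g
    linarith
end

section
/- (Extra-strong uncertainty principle.) Let f : ℝ → ℂ be a Schwartz function with ‖f‖_{L²} = 1 and f(t) ≠ 0 for all t, written in amplitude-phase form f(t) = ρ(t) e^{iφ(t)} with ρ(t) = |f(t)| > 0 and φ : ℝ → ℝ smooth. Define the means ⟨t⟩ = ∫_ℝ t |f(t)|² dt and ⟨ω⟩ = ∫_ℝ ω |\hat{f}(ω)|² dω, and the variances σ_t² = ∫_ℝ (t − ⟨t⟩)² |f(t)|² dt and σ_ω² = ∫_ℝ (ω − ⟨ω⟩)² |\hat{f}(ω)|² dω, where \hat{f}(ω) = (2π)^{-1/2} ∫_ℝ f(t) e^{-iωt} dt. Then σ_t² σ_ω² ≥ 1/4 + ( ∫_ℝ |t − ⟨t⟩| · |φ'(t) − ⟨ω⟩| · |f(t)|² dt )². -/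
open Complex MeasureTheory

open scoped FourierTransform in
/-- Plancherel for the modulated derivative. -/
lemma esup_plancherel (f : SchwartzMap ℝ ℂ) (w : ℝ) (fhat : ℝ → ℂ)
    (hfhat : ∀ ω : ℝ, fhat ω = ((Real.sqrt (2 * Real.pi) : ℂ))⁻¹ *
        ∫ t : ℝ, f t * Complex.exp (-Complex.I * (ω : ℂ) * (t : ℂ)))
    (g : SchwartzMap ℝ ℂ) (hg : g = SchwartzMap.derivCLM ℂ ℂ f - (I * w) • f) :
    ∫ ω : ℝ, (ω - w) ^ 2 * ‖fhat ω‖ ^ 2 = ∫ t, ‖g t‖ ^ 2 := by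
  have hpi : (0 : ℝ) < 2 * Real.pi := by positivity
  have hF : ∀ ξ : ℝ, 𝓕 g ξ = (2 * Real.pi * ξ - w) * I * 𝓕 f ξ := by
    intro ξ
    have h1 : 𝓕 g = 𝓕 (SchwartzMap.derivCLM ℂ ℂ f) - (I * w) • 𝓕 f := by
      rw [hg, ← SchwartzMap.fourierTransformCLM_apply ℂ, map_sub, map_smul]
      simp
    have h2 : 𝓕 (SchwartzMap.derivCLM ℂ ℂ f) ξ = (2 * Real.pi * I * ξ) * 𝓕 f ξ := by
      have := congrFun (Real.fourier_deriv (f := f) f.integrable f.differentiable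
        (SchwartzMap.derivCLM ℂ ℂ f).integrable) ξ
      have e : (SchwartzMap.derivCLM ℂ ℂ f : ℝ → ℂ) = deriv f := by
        ext x
        simp
      rw [SchwartzMap.fourier_coe, SchwartzMap.fourier_coe, e, this, smul_eq_mul]
    rw [h1, _root_.sub_apply, h2, _root_.smul_apply, smul_eq_mul]
    ring
  have hfh : ∀ ω : ℝ, ‖fhat ω‖ ^ 2 = (2 * Real.pi)⁻¹ * ‖𝓕 f (ω / (2 * Real.pi))‖ ^ 2 := by
    intro ω
    have : 𝓕 f (ω / (2 * Real.pi)) =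
        ∫ t : ℝ, f t * Complex.exp (-Complex.I * (ω : ℂ) * (t : ℂ)) := by
      rw [SchwartzMap.fourier_coe, Real.fourier_real_eq_integral_exp_smul]
      congr 1 with t
      rw [smul_eq_mul, mul_comm]
      congr 2
      push_cast
      have : (Real.pi : ℂ) ≠ 0 := by exact_mod_cast Real.pi_ne_zero
      field_simp
    rw [hfhat, ← this, norm_mul, mul_pow, norm_inv, Complex.norm_real, Real.norm_eq_abs, inv_pow,
      sq_abs, Real.sq_sqrt hpi.le]
  rw [← SchwartzMap.integral_norm_sq_fourier g]
  have key : ∀ ω : ℝ, (ω - w) ^ 2 * ‖fhat ω‖ ^ 2 =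
      (2 * Real.pi)⁻¹ * (fun ξ : ℝ => ‖𝓕 g ξ‖ ^ 2) (ω / (2 * Real.pi)) := by
    intro ω
    have h3 : (2 * Real.pi * ((ω / (2 * Real.pi) : ℝ) : ℂ) - w : ℂ) = ((ω - w : ℝ) : ℂ) := by
      have : (Real.pi : ℂ) ≠ 0 := by exact_mod_cast Real.pi_ne_zero
      push_cast
      field_simp
    simp only [hF, hfh, h3]
    rw [norm_mul, norm_mul, Complex.norm_I, Complex.norm_real, Real.norm_eq_abs, mul_one, mul_pow,
      sq_abs]
    ring
  simp_rw [key]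
  rw [integral_const_mul, Measure.integral_comp_div (fun ξ : ℝ => ‖𝓕 g ξ‖ ^ 2), abs_of_pos hpi, smul_eq_mul,
    inv_mul_cancel_left₀ (ne_of_gt hpi)]

/-- Cauchy-Schwarz for two Schwartz functions. -/
lemma esup_cs (h g : SchwartzMap ℝ ℂ) :
    (∫ t, ‖h t‖ * ‖g t‖) ^ 2 ≤ (∫ t, ‖h t‖ ^ 2) * ∫ t, ‖g t‖ ^ 2 := by
  have := integral_mul_le_Lp_mul_Lq_of_nonneg (μ := (volume : Measure ℝ))
    Real.HolderConjugate.two_two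
    (f := fun t => ‖h t‖) (g := fun t => ‖g t‖) (.of_forall fun _ => norm_nonneg _)
    (.of_forall fun _ => norm_nonneg _) (h.memLp _ _).norm (g.memLp _ _).norm
  have hA : 0 ≤ ∫ t, ‖h t‖ ^ 2 := integral_nonneg fun _ => by positivity
  have hB : 0 ≤ ∫ t, ‖g t‖ ^ 2 := integral_nonneg fun _ => by positivity
  have h0 : 0 ≤ ∫ t, ‖h t‖ * ‖g t‖ := integral_nonneg fun _ => by positivity
  simp only [Real.rpow_two, ← Real.sqrt_eq_rpow] at this
  calc _ ≤ _ := pow_le_pow_left₀ h0 this 2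
    _ = _ := by rw [mul_pow, Real.sq_sqrt hA, Real.sq_sqrt hB]

lemma esup_integrable_mul (h g : SchwartzMap ℝ ℂ) : Integrable fun t => ‖h t‖ * ‖g t‖ :=
  (h.memLp 2 volume).norm.integrable_mul (g.memLp 2 volume).norm

/-- Extra-strong uncertainty principle: For a nowhere-vanishing Schwartz
function `f` with `‖f‖_{L²} = 1`, written `f = ρ e^{iφ}` with `ρ = |f| > 0` and smooth
real phase `φ`, and with Fourier transform `f̂(ω) = (2π)^{-1/2} ∫ f(t) e^{-iωt} dt`, means
`⟨t⟩, ⟨ω⟩` and variances `σ_t², σ_ω²`, one has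
`σ_t² σ_ω² ≥ 1/4 + (∫ |t − ⟨t⟩|·|φ'(t) − ⟨ω⟩|·|f(t)|² dt)²`. -/
theorem extra_strong_uncertainty_principle
    (f : SchwartzMap ℝ ℂ)
    (hnorm : (∫ t : ℝ, ‖f t‖ ^ 2) = 1)
    (hne : ∀ t : ℝ, f t ≠ 0)
    (ρ φ : ℝ → ℝ)
    (hρ : ∀ t, ρ t = ‖f t‖)
    (hρpos : ∀ t, 0 < ρ t)
    (hφ : ContDiff ℝ (⊤ : ℕ∞) φ)
    (hpolar : ∀ t, f t = (ρ t : ℂ) * Complex.exp (Complex.I * (φ t : ℂ)))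
    (fhat : ℝ → ℂ)
    (hfhat : ∀ ω : ℝ, fhat ω = ((Real.sqrt (2 * Real.pi) : ℂ))⁻¹ *
        ∫ t : ℝ, f t * Complex.exp (-Complex.I * (ω : ℂ) * (t : ℂ)))
    (tm ωm σt2 σω2 : ℝ)
    (htm : tm = ∫ t : ℝ, t * ‖f t‖ ^ 2)
    (hωm : ωm = ∫ ω : ℝ, ω * ‖fhat ω‖ ^ 2)
    (hσt : σt2 = ∫ t : ℝ, (t - tm) ^ 2 * ‖f t‖ ^ 2)
    (hσω : σω2 = ∫ ω : ℝ, (ω - ωm) ^ 2 * ‖fhat ω‖ ^ 2) :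
    1 / 4 + (∫ t : ℝ, |t - tm| * |deriv φ t - ωm| * ‖f t‖ ^ 2) ^ 2 ≤ σt2 * σω2 := by
  set g : SchwartzMap ℝ ℂ := SchwartzMap.derivCLM ℂ ℂ f - (I * ωm) • f with hg
  have hgt : ∀ t, g t = deriv f t - I * ωm * f t := fun t => by simp [hg]
  rw [hσω, esup_plancherel f ωm fhat hfhat g hg]
  have htg : (fun t : ℝ => t - tm).HasTemperateGrowth := by fun_prop
  set h : SchwartzMap ℝ ℂ := SchwartzMap.smulLeftCLM ℂ (fun t : ℝ => t - tm) f with hh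
  have hht : ∀ t, h t = ((t - tm : ℝ) : ℂ) * f t := fun t => by
    rw [hh, SchwartzMap.smulLeftCLM_apply_apply htg, Complex.real_smul]
  have hhn : ∀ t, ‖h t‖ = |t - tm| * ‖f t‖ := fun t => by
    rw [hht, norm_mul, Complex.norm_real, Real.norm_eq_abs]
  have hσt' : σt2 = ∫ t, ‖h t‖ ^ 2 := by
    rw [hσt]
    congr 1 with t
    rw [hhn, mul_pow, sq_abs]
  rw [hσt']
  refine le_trans ?_ (esup_cs h g)
  have hsc : Continuous fun t : ℝ => t - tm := by fun_prop
  set P : ℝ → ℂ := fun t => (starRingEnd ℂ) (f t) * g t with hP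
  have hPc : Continuous P := by
    have := f.continuous
    have := g.continuous
    fun_prop
  have hPn : ∀ t, ‖P t‖ = ‖f t‖ * ‖g t‖ := fun t => by simp [hP]
  set X : ℝ → ℝ := fun t => (t - tm) * (P t).re with hX
  set Y : ℝ → ℝ := fun t => |t - tm| * |(P t).im| with hY
  have hXc : Continuous X := hsc.mul (Complex.continuous_re.comp hPc)
  have hYc : Continuous Y := hsc.abs.mul (Complex.continuous_im.comp hPc).abs
  have hXi : Integrable X := by
    refine (esup_integrable_mul h g).mono' hXc.aestronglyMeasurable (.of_forall fun t => ?_)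
    rw [hX, Real.norm_eq_abs, abs_mul, hhn, mul_assoc, ← hPn]
    gcongr
    exact Complex.abs_re_le_norm _
  have hYi : Integrable Y := by
    refine (esup_integrable_mul h g).mono' hYc.aestronglyMeasurable (.of_forall fun t => ?_)
    rw [hY, Real.norm_eq_abs, abs_mul, abs_abs, abs_abs, hhn, mul_assoc, ← hPn]
    gcongr
    exact Complex.abs_im_le_norm _
  -- the norm of the complex integral
  have hZ : (∫ t, X t) ^ 2 + (∫ t, Y t) ^ 2 ≤ (∫ t, ‖h t‖ * ‖g t‖) ^ 2 := by
    have e1 : (∫ t, ((X t : ℂ) + (Y t : ℂ) * I)) = ((∫ t, X t : ℝ) : ℂ) + ((∫ t, Y t : ℝ) : ℂ) * I := by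
      have hXi' : Integrable fun t => (X t : ℂ) := hXi.ofReal
      have hYi' : Integrable fun t => (Y t : ℂ) := hYi.ofReal
      rw [integral_add hXi' (hYi'.mul_const I), integral_mul_const,
        integral_complex_ofReal, integral_complex_ofReal]
    have e2 : ∀ t, ‖(X t : ℂ) + (Y t : ℂ) * I‖ = ‖h t‖ * ‖g t‖ := by
      intro t
      rw [Complex.norm_add_mul_I, hhn, mul_assoc, ← hPn]
      have : X t ^ 2 + Y t ^ 2 = (|t - tm| * ‖P t‖) ^ 2 := by
        simp only [hX, hY, mul_pow, sq_abs, Complex.sq_norm, Complex.normSq_apply]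
        ring
      rw [this, Real.sqrt_sq (by positivity)]
    have e3 := norm_integral_le_integral_norm (μ := volume) (fun t => (X t : ℂ) + (Y t : ℂ) * I)
    simp only [e2] at e3
    rw [e1, Complex.norm_add_mul_I] at e3
    exact (Real.sqrt_le_left (integral_nonneg fun _ => by positivity)).1 e3
  refine le_trans (le_of_eq ?_) hZ
  -- real part
  have hff : Integrable fun t => ‖f t‖ ^ 2 := by
    simpa [sq] using esup_integrable_mul f f
  have hre : ∫ t, X t = -1 / 2 := by
    have hd : ∀ t, HasDerivAt (fun t => (t - tm) * ‖f t‖ ^ 2) (‖f t‖ ^ 2 + 2 * X t) t := by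
      intro t
      have d1 := ((hasDerivAt_id t).sub_const tm).mul (f.hasDerivAt t).norm_sq
      convert! d1 using 1
      simp only [hX, hP, hgt, Complex.inner, Complex.mul_re, Complex.conj_re, Complex.conj_im,
        Complex.sub_re, Complex.sub_im, Complex.mul_im, Complex.I_re, Complex.I_im,
        Complex.ofReal_re, Complex.ofReal_im, id]
      ring
    have hi : Integrable fun t => (t - tm) * ‖f t‖ ^ 2 := by
      refine (esup_integrable_mul h f).mono' ?_ (.of_forall fun t => ?_)
      · exact (hsc.mul (f.continuous.norm.pow 2)).aestronglyMeasurable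
      · rw [hhn, Real.norm_eq_abs, abs_mul, abs_of_nonneg (sq_nonneg ‖f t‖)]
        apply le_of_eq
        ring
    have := integral_eq_zero_of_hasDerivAt_of_integrable hd (hff.add (hXi.const_mul 2)) hi
    rw [integral_add hff (hXi.const_mul 2), integral_const_mul, hnorm] at this
    linarith
  -- imaginary part
  have him : ∀ t, (P t).im = (deriv φ t - ωm) * ‖f t‖ ^ 2 := by
    intro t
    have hρd : HasDerivAt ρ (deriv ρ t) t := by
      have : ρ = fun t => ‖f t‖ := funext hρ
      rw [this]
      exact ((f.differentiable t).norm ℂ (hne t)).hasDerivAt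
    have hφd : HasDerivAt φ (deriv φ t) t := (hφ.differentiable (by simp) t).hasDerivAt
    have hfd : HasDerivAt f (((deriv ρ t : ℝ) : ℂ) * Complex.exp (I * φ t) +
        ρ t * (Complex.exp (I * φ t) * (I * ((deriv φ t : ℝ) : ℂ)))) t := by
      have := hρd.ofReal_comp.mul ((hφd.ofReal_comp.const_mul I).cexp)
      convert! this using 1
      ext s
      exact hpolar s
    have hE : (starRingEnd ℂ) (Complex.exp (I * φ t)) * Complex.exp (I * φ t) = 1 := by
      rw [← Complex.exp_conj, ← Complex.exp_add]
      simp
    have : P t = ((ρ t * deriv ρ t : ℝ) : ℂ) + (((deriv φ t - ωm) * ρ t ^ 2 : ℝ) : ℂ) * I := by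
      simp only [hP, hgt, hfd.deriv]
      rw [hpolar t, map_mul, Complex.conj_ofReal]
      push_cast
      linear_combination ((ρ t : ℂ) * ((deriv ρ t : ℝ) : ℂ) + (((deriv φ t : ℝ) : ℂ) - ωm) * ρ t ^ 2 * I) * hE
    rw [this, ← hρ, Complex.add_im, Complex.ofReal_im, Complex.im_ofReal_mul, Complex.I_im, mul_one, zero_add]
  have hYe : (fun t : ℝ => |t - tm| * |deriv φ t - ωm| * ‖f t‖ ^ 2) = Y := by
    ext t
    simp only [hY, him, abs_mul, abs_of_nonneg (sq_nonneg ‖f t‖)]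
    ring
  rw [hYe, hre]
  norm_num
end
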